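/- arXiv:1201.5361 — 2 statements merged into one kernel-verified Lean document; each statement's English description precedes it below -/
import Mathlib

section
/- Every proper subgraph of M_7 is 3-colorable (so M_7 is 4-critical). -/
open SimpleGraph

/-- The join `K + L` of two graphs: disjoint union plus all cross edges. -/
def graphJoin {V W : Type*} (G : SimpleGraph V) (H : SimpleGraph W) :
    SimpleGraph (V ⊕ W) :=
  SimpleGraph.fromRel fun x y =>
    match x, y with
    | Sum.inl a, Sum.inl b => G.Adj a b
    | Sum.inr a, Sum.inr b => H.Adj a b
    | Sum.inl _, Sum.inr _ => True
    | Sum.inr _, Sum.inl _ => False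

/-- The cycle `C_n` on `n` vertices (vertex set `ZMod n`, `i ~ j` iff `i - j = ±1`). -/
def cyc (n : ℕ) : SimpleGraph (ZMod n) :=
  SimpleGraph.fromRel fun i j => i - j = 1

/-- The Moser spindle `H_7`: vertices `0 = z, 1 = a1, 2 = a2, 3 = b, 4 = c1, 5 = c2, 6 = d`. -/
def H7 : SimpleGraph (Fin 7) :=
  SimpleGraph.fromRel fun i j => (i.val, j.val) ∈
    [(0,1), (0,2), (1,2), (1,3), (2,3), (0,4), (0,5), (4,5), (4,6), (5,6), (3,6)]

/-- `M_7`: vertices `0..5 = x1..x6` on a 6-cycle with chords `x1x3, x3x5, x5x1`,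
and `6 = v` joined to `x2, x4, x6`. -/
def M7 : SimpleGraph (Fin 7) :=
  SimpleGraph.fromRel fun i j => (i.val, j.val) ∈
    [(0,1), (1,2), (2,3), (3,4), (4,5), (5,0), (0,2), (2,4), (4,0), (6,1), (6,3), (6,5)]

/-- `T_11`: the graph on `ZMod 11` where distinct `i, j` are adjacent iff
`i - j ≡ ±1, ±2, ±3 (mod 11)`. -/
def T11 : SimpleGraph (ZMod 11) :=
  SimpleGraph.fromRel fun i j => i - j = 1 ∨ i - j = 2 ∨ i - j = 3

instance : DecidableRel M7.Adj := fun i j =>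
  inferInstanceAs (Decidable (i ≠ j ∧ (_ ∈ _ ∨ _ ∈ _)))

/-- Every edge of `M7` is the only monochromatic edge of some assignment of three colors. -/
lemma M7_exists_coloring_of_adj : ∀ a b, M7.Adj a b →
    ∃ c : Fin 7 → Fin 3, ∀ i j, M7.Adj i j → c i = c j → s(i, j) = s(a, b) := by
  have key : ∀ a b, M7.Adj a b → ∃ c ∈ ([
      ![0, 2, 1, 0, 2, 1, 0], ![0, 2, 1, 0, 2, 1, 1], ![0, 2, 1, 0, 2, 1, 2],
      ![0, 0, 1, 0, 2, 1, 2], ![0, 1, 1, 0, 2, 1, 2], ![0, 2, 1, 1, 2, 1, 0],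
      ![0, 2, 1, 2, 2, 1, 0], ![0, 2, 1, 0, 2, 2, 1], ![0, 2, 1, 0, 2, 0, 1],
      ![0, 2, 0, 2, 1, 2, 0], ![1, 2, 0, 2, 0, 2, 0], ![0, 2, 1, 2, 0, 2, 0]] :
        List (Fin 7 → Fin 3)),
      ∀ i j, M7.Adj i j → c i = c j → s(i, j) = s(a, b) := by
    decide +kernel
  intro a b hab
  obtain ⟨c, -, hc⟩ := key a b hab
  exact ⟨c, hc⟩

lemma M7_exists_adj : ∀ a, ∃ b, M7.Adj a b := by
  decide +kernel

/-- A proper subgraph of a graph without isolated vertices misses an edge. -/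
lemma SimpleGraph.Subgraph.exists_adj_not_adj_of_ne_top {V : Type*} {G : SimpleGraph V}
    (hG : ∀ a, ∃ b, G.Adj a b) {H : G.Subgraph} (hH : H ≠ ⊤) :
    ∃ a b, G.Adj a b ∧ ¬ H.Adj a b := by
  by_contra! h
  apply hH
  ext a b
  · obtain ⟨b, hb⟩ := hG a
    simpa using (h a b hb).fst_mem
  · exact ⟨fun hab => hab.adj_sub, h a b⟩

/-- Every proper subgraph of `M_7` is 3-colorable (so `M_7` is 4-critical). -/
theorem m7_proper_subgraphs_three_colorable :
    ∀ H : M7.Subgraph, H ≠ ⊤ → H.coe.Colorable 3 := by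
  intro H hH
  obtain ⟨a, b, hab, hnot⟩ := Subgraph.exists_adj_not_adj_of_ne_top M7_exists_adj hH
  obtain ⟨c, hc⟩ := M7_exists_coloring_of_adj a b hab
  refine ⟨Coloring.mk (fun x => c x) fun {x y} hxy heq => hnot ?_⟩
  have hxy' : H.Adj x y := hxy
  rw [← Subgraph.mem_edgeSet, ← hc x y hxy'.adj_sub heq]
  exact hxy'
end

section
/- The graph K_2 + M_7 is not 5-colorable. -/
open SimpleGraph

/-- Five pairwise distinct elements of `Fin 5` exhaust it. -/
theorem eq_of_ne_four {a b c d e x : Fin 5} (h : [a, b, c, d, e].Nodup)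
    (ha : x ≠ a) (hb : x ≠ b) (hc : x ≠ c) (hd : x ≠ d) : x = e := by
  simp only [List.nodup_cons, List.mem_cons, List.not_mem_nil] at h
  omega

theorem graphJoin_adj_inl_inr {V W : Type*} (G : SimpleGraph V) (H : SimpleGraph W)
    (v : V) (w : W) : (graphJoin G H).Adj (Sum.inl v) (Sum.inr w) := by
  simp [graphJoin]

theorem graphJoin_adj_inl_inl {V W : Type*} (G : SimpleGraph V) (H : SimpleGraph W)
    {v w : V} (h : G.Adj v w) : (graphJoin G H).Adj (Sum.inl v) (Sum.inl w) := by
  simp [graphJoin, h, h.ne]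

theorem graphJoin_adj_inr_inr {V W : Type*} (G : SimpleGraph V) (H : SimpleGraph W)
    {v w : W} (h : H.Adj v w) : (graphJoin G H).Adj (Sum.inr v) (Sum.inr w) := by
  simp [graphJoin, h, h.ne]

/-- The graph `K_2 + M_7` is not 5-colorable. -/
theorem k2_join_m7_not_five_colorable :
    ¬ (graphJoin (⊤ : SimpleGraph (Fin 2)) M7).Colorable 5 := by
  rintro ⟨C⟩
  have hub : C (Sum.inl 0) ≠ C (Sum.inl 1) :=
    C.valid (graphJoin_adj_inl_inl _ _ (by simp))
  have hu (i : Fin 2) (j : Fin 7) : C (Sum.inl i) ≠ C (Sum.inr j) :=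
    C.valid (graphJoin_adj_inl_inr _ _ i j)
  have hm {i j : Fin 7} (h : M7.Adj i j) : C (Sum.inr i) ≠ C (Sum.inr j) :=
    C.valid (graphJoin_adj_inr_inr _ _ h)
  have h02 := hm (i := 0) (j := 2) (by simp [M7])
  have h24 := hm (i := 2) (j := 4) (by simp [M7])
  have h40 := hm (i := 4) (j := 0) (by simp [M7])
  have h1 : C (Sum.inr 1) = C (Sum.inr 4) :=
    eq_of_ne_four (by simp [hub, hu, h02, h24, h40.symm]) (hu 0 1).symm (hu 1 1).symm
      (hm (j := 0) (by simp [M7])) (hm (j := 2) (by simp [M7]))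
  have h3 : C (Sum.inr 3) = C (Sum.inr 0) :=
    eq_of_ne_four (by simp [hub, hu, h02.symm, h24, h40]) (hu 0 3).symm (hu 1 3).symm
      (hm (j := 2) (by simp [M7])) (hm (j := 4) (by simp [M7]))
  have h5 : C (Sum.inr 5) = C (Sum.inr 2) :=
    eq_of_ne_four (by simp [hub, hu, h02, h24.symm, h40]) (hu 0 5).symm (hu 1 5).symm
      (hm (j := 4) (by simp [M7])) (hm (j := 0) (by simp [M7]))
  -- Both colors of `K_2` and two of the triangle are excluded at the apex, so the third remains.
  have h6 : C (Sum.inr 6) = C (Sum.inr 4) :=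
    eq_of_ne_four (by simp [hub, hu, h02, h24, h40.symm]) (hu 0 6).symm (hu 1 6).symm
      (h3 ▸ hm (i := 6) (j := 3) (by simp [M7]))
      (h5 ▸ hm (i := 6) (j := 5) (by simp [M7]))
  exact hm (i := 6) (j := 1) (by simp [M7]) (h6.trans h1.symm)
end
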